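/- arXiv:2106.13781 — 2 statements merged into one kernel-verified Lean document; each statement's English description precedes it below -/
import Mathlib

section
/- Let f, g : ℝ^d × ℝ^{d'} → ℝ be such that f is ℓ_{f,0}-Lipschitz continuous with ℓ_{f,1}-Lipschitz gradient, g is twice continuously differentiable with ℓ_{g,1}-Lipschitz gradient and ℓ_{g,2}-Lipschitz Hessian, and y ↦ g(x,y) is μ_g-strongly convex for every x with μ_g > 0. Define ∇̄_x f(x,y) := ∇_x f(x,y) − ∇²_{xy} g(x,y) [∇²_{yy} g(x,y)]⁻¹ ∇_y f(x,y) and the constant L_f := ℓ_{f,1} + ℓ_{g,1}ℓ_{f,1}/μ_g + (ℓ_{f,0}/μ_g)(ℓ_{g,2} + ℓ_{g,1}ℓ_{g,2}/μ_g). Then for every x ∈ ℝ^d and every y ∈ ℝ^{d'}, writing y*(x) = argmin_y g(x,y), one has ‖∇̄_x f(x, y*(x)) − ∇̄_x f(x, y)‖ ≤ L_f ‖y*(x) − y‖. -/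
open scoped InnerProductSpace

noncomputable section

/-- ℝ^d with the Euclidean norm. -/
abbrev Euc (d : ℕ) := EuclideanSpace ℝ (Fin d)

/-- The pair `(x, y)` viewed as an element of `ℝ^d × ℝ^{d'}` equipped with the
Euclidean (ℓ²-product) norm. -/
def prodPt {d d' : ℕ} (x : Euc d) (y : Euc d') : WithLp 2 (Euc d × Euc d') :=
  (WithLp.equiv 2 (Euc d × Euc d')).symm (x, y)

/-- The surrogate bilevel gradient
`∇̄_x f(x,y) = ∇_x f(x,y) − ∇²_{xy} g(x,y) [∇²_{yy} g(x,y)]⁻¹ ∇_y f(x,y)`. -/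
def surrogateGrad {d d' : ℕ} (f g : WithLp 2 (Euc d × Euc d') → ℝ)
    (x : Euc d) (y : Euc d') : Euc d :=
  gradient (fun x' : Euc d => f (prodPt x' y)) x
    - (ContinuousLinearMap.adjoint
        (fderiv ℝ (fun x' : Euc d =>
          gradient (fun y' : Euc d' => g (prodPt x' y')) y) x))
      ((Ring.inverse
          (fderiv ℝ (fun y' : Euc d' =>
            gradient (fun y'' : Euc d' => g (prodPt x y'')) y') y))
        (gradient (fun y' : Euc d' => f (prodPt x y')) y))

abbrev PW (d d' : ℕ) := WithLp 2 (Euc d × Euc d')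

def inX (d d' : ℕ) : Euc d →L[ℝ] PW d d' :=
  (WithLp.prodContinuousLinearEquiv 2 ℝ (Euc d) (Euc d')).symm.toContinuousLinearMap.comp
    (ContinuousLinearMap.inl ℝ (Euc d) (Euc d'))

def inY (d d' : ℕ) : Euc d' →L[ℝ] PW d d' :=
  (WithLp.prodContinuousLinearEquiv 2 ℝ (Euc d) (Euc d')).symm.toContinuousLinearMap.comp
    (ContinuousLinearMap.inr ℝ (Euc d) (Euc d'))

lemma inX_norm {d d' : ℕ} (v : Euc d) : ‖inX d d' v‖ = ‖v‖ :=
  WithLp.norm_toLp_fst 2 (Euc d) (Euc d') v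

lemma inY_norm {d d' : ℕ} (v : Euc d') : ‖inY d d' v‖ = ‖v‖ :=
  WithLp.norm_toLp_snd 2 (Euc d) (Euc d') v

lemma inX_opNorm {d d' : ℕ} : ‖inX d d'‖ ≤ 1 :=
  ContinuousLinearMap.opNorm_le_bound _ zero_le_one (fun v => by rw [inX_norm, one_mul])

lemma inY_opNorm {d d' : ℕ} : ‖inY d d'‖ ≤ 1 :=
  ContinuousLinearMap.opNorm_le_bound _ zero_le_one (fun v => by rw [inY_norm, one_mul])

lemma prodPt_eq {d d' : ℕ} (x : Euc d) (y : Euc d') :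
    prodPt x y = inX d d' x + inY d d' y := by
  change WithLp.toLp 2 (x, y) = WithLp.toLp 2 (x, 0) + WithLp.toLp 2 (0, y)
  rw [← WithLp.toLp_add]
  simp

lemma prodPt_x {d d' : ℕ} (x : Euc d) (y : Euc d') :
    HasFDerivAt (fun x' => prodPt x' y) (inX d d') x := by
  simp only [prodPt_eq]
  exact (inX d d').hasFDerivAt.add_const _

lemma prodPt_y {d d' : ℕ} (x : Euc d) (y : Euc d') :
    HasFDerivAt (fun y' => prodPt x y') (inY d d') y := by
  simp only [prodPt_eq]
  exact (inY d d').hasFDerivAt.const_add _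

lemma prodPt_sub_y {d d' : ℕ} (x : Euc d) (y y' : Euc d') :
    ‖prodPt x y - prodPt x y'‖ = ‖y - y'‖ := by
  rw [prodPt_eq, prodPt_eq, add_sub_add_left_eq_sub, ← map_sub, inY_norm]

lemma grad_comp {E W : Type*} [NormedAddCommGroup E] [InnerProductSpace ℝ E] [CompleteSpace E]
    [NormedAddCommGroup W] [InnerProductSpace ℝ W] [CompleteSpace W]
    {F : W → ℝ} {a : E → W} {L : E →L[ℝ] W} {z : E}
    (ha : HasFDerivAt a L z) (hF : DifferentiableAt ℝ F (a z)) :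
    gradient (fun e => F (a e)) z = ContinuousLinearMap.adjoint L (gradient F (a z)) := by
  have h := hF.hasFDerivAt.comp z ha
  refine ext_inner_right ℝ (fun v => ?_)
  rw [inner_gradient_left, ContinuousLinearMap.adjoint_inner_left, inner_gradient_left]
  exact congrArg (fun T => T v) h.fderiv

lemma grad_differentiable {W : Type*} [NormedAddCommGroup W] [InnerProductSpace ℝ W]
    [CompleteSpace W] {g : W → ℝ} (hg : ContDiff ℝ 2 g) : Differentiable ℝ (gradient g) := by
  have h : Differentiable ℝ (fderiv ℝ g) :=
    (hg.fderiv_right (m := 1) (by norm_num)).differentiable (by norm_num)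
  exact ((InnerProductSpace.toDual ℝ W).symm.toContinuousLinearEquiv.differentiable).comp h

lemma strong_coercive {E : Type*} [NormedAddCommGroup E] [InnerProductSpace ℝ E]
    [CompleteSpace E] {h : E → ℝ} {μ : ℝ} (hd : Differentiable ℝ h)
    (hs : StrongConvexOn Set.univ μ h) {y : E} {B : E →L[ℝ] E}
    (hB : HasFDerivAt (gradient h) B y) (v : E) : μ * ‖v‖ ^ 2 ≤ ⟪B v, v⟫_ℝ := by
  have hc := strongConvexOn_iff_convex.1 hs
  have hl : ∀ t : ℝ, HasDerivAt (fun t : ℝ => y + t • v) v t := fun t => by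
    simpa using ((hasDerivAt_id t).smul_const v).const_add y
  have hc2 : ConvexOn ℝ Set.univ (fun t : ℝ => h (y + t • v) - μ / 2 * ‖y + t • v‖ ^ 2) := by
    have := hc.comp_affineMap (AffineMap.lineMap y (y + v) : ℝ →ᵃ[ℝ] E)
    simpa [AffineMap.lineMap_apply, Function.comp_def, add_comm] using this
  have hd1 : ∀ t : ℝ, HasDerivAt (fun t : ℝ => h (y + t • v) - μ / 2 * ‖y + t • v‖ ^ 2)
      (⟪gradient h (y + t • v), v⟫_ℝ - μ * ⟪y + t • v, v⟫_ℝ) t := fun t => by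
    have h1 := (hd (y + t • v)).hasFDerivAt.comp_hasDerivAt t (hl t)
    have h2 := ((hl t).norm_sq).const_mul (μ / 2)
    have h3 := h1.sub h2
    rw [inner_gradient_left]
    exact h3.congr_deriv (by ring)
  have hm : Monotone (fun t : ℝ => ⟪gradient h (y + t • v), v⟫_ℝ - μ * ⟪y + t • v, v⟫_ℝ) := by
    have := hc2.monotoneOn_deriv (fun t _ => (hd1 t).differentiableAt)
    rw [monotoneOn_univ] at this
    rwa [funext fun t => (hd1 t).deriv] at this
  have hB' : HasFDerivAt (gradient h) B (y + (0 : ℝ) • v) := by simpa using hB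
  have hd2 : HasDerivAt (fun t : ℝ => ⟪gradient h (y + t • v), v⟫_ℝ - μ * ⟪y + t • v, v⟫_ℝ)
      (⟪B v, v⟫_ℝ - μ * ⟪v, v⟫_ℝ) 0 := by
    have h1 := (hB'.comp_hasDerivAt (0 : ℝ) (hl 0)).inner ℝ (hasDerivAt_const (0 : ℝ) v)
    have h2 := ((hl 0).inner ℝ (hasDerivAt_const (0 : ℝ) v)).const_mul μ
    exact (h1.sub h2).congr_deriv (by simp)
  have := hm.deriv_nonneg (x := 0)
  rw [hd2.deriv, real_inner_self_eq_norm_sq] at this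
  linarith

lemma coercive_below {E : Type*} [NormedAddCommGroup E] [InnerProductSpace ℝ E]
    {μ : ℝ} {B : E →L[ℝ] E} (h : ∀ v, μ * ‖v‖ ^ 2 ≤ ⟪B v, v⟫_ℝ) (v : E) :
    μ * ‖v‖ ≤ ‖B v‖ := by
  rcases eq_or_ne v 0 with rfl | hv
  · simp
  · have hp : 0 < ‖v‖ := norm_pos_iff.2 hv
    have h1 := (h v).trans (real_inner_le_norm (B v) v)
    refine le_of_mul_le_mul_right ?_ hp
    linarith [sq ‖v‖, mul_assoc μ ‖v‖ ‖v‖, h1, congrArg (fun z => μ * z) (sq ‖v‖)]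

lemma coercive_inverse {E : Type*} [NormedAddCommGroup E] [InnerProductSpace ℝ E]
    [FiniteDimensional ℝ E] [CompleteSpace E]
    {μ : ℝ} (hμ : 0 < μ) {B : E →L[ℝ] E} (h : ∀ v, μ * ‖v‖ ≤ ‖B v‖) (v : E) :
    B (Ring.inverse B v) = v := by
  have hu : IsUnit B := by
    rw [ContinuousLinearMap.isUnit_iff_isUnit_toLinearMap, LinearMap.isUnit_iff_ker_eq_bot,
      LinearMap.ker_eq_bot']
    intro m hm
    have h1 := h m
    have h2 : B m = 0 := hm
    rw [h2, norm_zero] at h1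
    by_contra hne
    have := mul_pos hμ (norm_pos_iff.2 hne)
    linarith
  have := Ring.mul_inverse_cancel B hu
  exact congrArg (fun T : E →L[ℝ] E => T v) this

lemma adj_comp_bound {d d' : ℕ} {V : Type*} [NormedAddCommGroup V] [NormedSpace ℝ V]
    {L : V →L[ℝ] PW d d'} (hL : ‖L‖ ≤ 1)
    {H : PW d d' →L[ℝ] PW d d'} {c : ℝ} (hH : ‖H‖ ≤ c) :
    ‖(ContinuousLinearMap.adjoint (inY d d')).comp (H.comp L)‖ ≤ c := by
  have h0 : ‖ContinuousLinearMap.adjoint (inY d d')‖ ≤ 1 := by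
    rw [LinearIsometryEquiv.norm_map]; exact inY_opNorm
  calc _ ≤ ‖ContinuousLinearMap.adjoint (inY d d')‖ * ‖H.comp L‖ :=
        ContinuousLinearMap.opNorm_comp_le _ _
    _ ≤ 1 * (‖H‖ * ‖L‖) := mul_le_mul h0 (ContinuousLinearMap.opNorm_comp_le _ _)
        (norm_nonneg _) zero_le_one
    _ ≤ 1 * (‖H‖ * 1) := by gcongr
    _ ≤ c := by linarith

lemma adj_apply_bound {E W : Type*} [NormedAddCommGroup E] [InnerProductSpace ℝ E]
    [CompleteSpace E] [NormedAddCommGroup W] [InnerProductSpace ℝ W] [CompleteSpace W]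
    {L : E →L[ℝ] W} {k : ℝ} (hL : ‖L‖ ≤ k) (w : W) :
    ‖ContinuousLinearMap.adjoint L w‖ ≤ k * ‖w‖ := by
  refine ContinuousLinearMap.le_of_opNorm_le _ ?_ w
  rw [LinearIsometryEquiv.norm_map]; exact hL

theorem surrogate_gradient_lipschitz_in_y {d d' : ℕ}
    (f g : WithLp 2 (Euc d × Euc d') → ℝ)
    (ℓf0 ℓf1 ℓg1 ℓg2 : ℝ)
    (hfLip : ∀ p q : WithLp 2 (Euc d × Euc d'), |f p - f q| ≤ ℓf0 * ‖p - q‖)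
    (hfdiff : Differentiable ℝ f)
    (hfgradLip : ∀ p q : WithLp 2 (Euc d × Euc d'),
      ‖gradient f p - gradient f q‖ ≤ ℓf1 * ‖p - q‖)
    (hg : ContDiff ℝ 2 g)
    (hggradLip : ∀ p q : WithLp 2 (Euc d × Euc d'),
      ‖gradient g p - gradient g q‖ ≤ ℓg1 * ‖p - q‖)
    (hghessLip : ∀ p q : WithLp 2 (Euc d × Euc d'),
      ‖fderiv ℝ (gradient g) p - fderiv ℝ (gradient g) q‖ ≤ ℓg2 * ‖p - q‖)
    (μg : ℝ) (hμg : 0 < μg)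
    (hstrong : ∀ x : Euc d,
      StrongConvexOn Set.univ μg (fun y : Euc d' => g (prodPt x y)))
    (ystar : Euc d → Euc d')
    (hmin : ∀ (x : Euc d) (y : Euc d'), g (prodPt x (ystar x)) ≤ g (prodPt x y))
    (huniq : ∀ (x : Euc d) (y : Euc d'),
      (∀ y' : Euc d', g (prodPt x y) ≤ g (prodPt x y')) → y = ystar x) :
    ∀ (x : Euc d) (y : Euc d'),
      ‖surrogateGrad f g x (ystar x) - surrogateGrad f g x y‖
        ≤ (ℓf1 + ℓg1 * ℓf1 / μg + (ℓf0 / μg) * (ℓg2 + ℓg1 * ℓg2 / μg))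
            * ‖ystar x - y‖ := by
  intro x y
  rcases eq_or_ne (ystar x) y with heq | hne
  · rw [heq]; simp
  have hδ : 0 < ‖ystar x - y‖ := norm_pos_iff.2 (sub_ne_zero.2 hne)
  generalize ystar x = z at hne hδ ⊢
  have hpq : ‖prodPt x z - prodPt x y‖ = ‖z - y‖ := prodPt_sub_y x z y
  have nonneg_of : ∀ {a k : ℝ}, 0 ≤ a → a ≤ k * ‖z - y‖ → 0 ≤ k := fun {a k} ha h =>
    nonneg_of_mul_nonneg_left (ha.trans h) hδ
  have hf0 : 0 ≤ ℓf0 := nonneg_of (abs_nonneg _) (hpq ▸ hfLip (prodPt x z) (prodPt x y))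
  have hg1 : 0 ≤ ℓg1 := nonneg_of (norm_nonneg _) (hpq ▸ hggradLip (prodPt x z) (prodPt x y))
  have hgd : Differentiable ℝ g := hg.differentiable (by norm_num)
  have hgg := grad_differentiable hg
  have hgy : ∀ (x' : Euc d) (y' : Euc d'), gradient (fun y'' : Euc d' => g (prodPt x' y'')) y'
      = ContinuousLinearMap.adjoint (inY d d') (gradient g (prodPt x' y')) := fun x' y' =>
    grad_comp (prodPt_y x' y') (hgd _)
  have hfx : ∀ y', gradient (fun x' : Euc d => f (prodPt x' y')) x
      = ContinuousLinearMap.adjoint (inX d d') (gradient f (prodPt x y')) := fun y' =>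
    grad_comp (prodPt_x x y') (hfdiff _)
  have hfy : ∀ y', gradient (fun y'' : Euc d' => f (prodPt x y'')) y'
      = ContinuousLinearMap.adjoint (inY d d') (gradient f (prodPt x y')) := fun y' =>
    grad_comp (prodPt_y x y') (hfdiff _)
  set H := fderiv ℝ (gradient g) with hH
  have hC : ∀ y', HasFDerivAt (fun x' : Euc d => gradient (fun y'' : Euc d' => g (prodPt x' y'')) y')
      ((ContinuousLinearMap.adjoint (inY d d')).comp ((H (prodPt x y')).comp (inX d d'))) x := by
    intro y'
    simp only [hgy]
    have h1 : HasFDerivAt (fun x' : Euc d => gradient g (prodPt x' y'))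
        ((H (prodPt x y')).comp (inX d d')) x :=
      HasFDerivAt.comp (g := gradient g) (f := fun x' : Euc d => prodPt x' y') x
        (hgg (prodPt x y')).hasFDerivAt (prodPt_x x y')
    exact (ContinuousLinearMap.hasFDerivAt _).comp x h1
  have hB : ∀ y', HasFDerivAt (fun y₁ : Euc d' => gradient (fun y'' : Euc d' => g (prodPt x y'')) y₁)
      ((ContinuousLinearMap.adjoint (inY d d')).comp ((H (prodPt x y')).comp (inY d d'))) y' := by
    intro y'
    simp only [hgy]
    exact (ContinuousLinearMap.hasFDerivAt _).comp y'
      ((hgg (prodPt x y')).hasFDerivAt.comp y' (prodPt_y x y'))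
  have hco : ∀ y' v, μg * ‖v‖ ≤ ‖((ContinuousLinearMap.adjoint (inY d d')).comp
      ((H (prodPt x y')).comp (inY d d'))) v‖ := by
    intro y'
    refine coercive_below (strong_coercive (h := fun y'' : Euc d' => g (prodPt x y'')) ?_
      (hstrong x) (hB y'))
    exact fun y₁ => (hgd _).comp y₁ (prodPt_y x y₁).differentiableAt
  have hHn : ∀ p, ‖H p‖ ≤ ℓg1 := fun p =>
    norm_fderiv_le_of_lip' ℝ hg1 (Filter.Eventually.of_forall fun q => hggradLip q p)
  have hHd : ‖H (prodPt x z) - H (prodPt x y)‖ ≤ ℓg2 * ‖z - y‖ := hpq ▸ hghessLip _ _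
  have hfn : ∀ p, ‖gradient f p‖ ≤ ℓf0 := fun p => by
    rw [gradient, LinearIsometryEquiv.norm_map]
    exact norm_fderiv_le_of_lip' ℝ hf0
      (Filter.Eventually.of_forall fun q => by simpa using hfLip q p)
  have hfd : ‖gradient f (prodPt x z) - gradient f (prodPt x y)‖ ≤ ℓf1 * ‖z - y‖ :=
    hpq ▸ hfgradLip _ _
  have hCn := fun y' => adj_comp_bound inX_opNorm (hHn (prodPt x y'))
  have hCd := adj_comp_bound (inX_opNorm (d := d) (d' := d')) hHd
  have hBd := adj_comp_bound (inY_opNorm (d := d) (d' := d')) hHd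
  rw [ContinuousLinearMap.sub_comp, ContinuousLinearMap.comp_sub] at hCd hBd
  have hbn : ‖ContinuousLinearMap.adjoint (inY d d') (gradient f (prodPt x y))‖ ≤ ℓf0 := by
    have := adj_apply_bound (inY_opNorm (d := d) (d' := d')) (gradient f (prodPt x y))
    linarith [hfn (prodPt x y)]
  have hbd : ‖ContinuousLinearMap.adjoint (inY d d') (gradient f (prodPt x z))
      - ContinuousLinearMap.adjoint (inY d d') (gradient f (prodPt x y))‖ ≤ ℓf1 * ‖z - y‖ := by
    rw [← map_sub]
    have := adj_apply_bound (inY_opNorm (d := d) (d' := d'))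
      (gradient f (prodPt x z) - gradient f (prodPt x y))
    linarith
  have had : ‖ContinuousLinearMap.adjoint (inX d d') (gradient f (prodPt x z))
      - ContinuousLinearMap.adjoint (inX d d') (gradient f (prodPt x y))‖ ≤ ℓf1 * ‖z - y‖ := by
    rw [← map_sub]
    have := adj_apply_bound (inX_opNorm (d := d) (d' := d'))
      (gradient f (prodPt x z) - gradient f (prodPt x y))
    linarith
  unfold surrogateGrad
  rw [(hC z).fderiv, (hC y).fderiv, (hB z).fderiv, (hB y).fderiv, hfx, hfx, hfy, hfy]
  have i1 := coercive_inverse hμg (hco z)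
    (ContinuousLinearMap.adjoint (inY d d') (gradient f (prodPt x z)))
  have i2 := coercive_inverse hμg (hco y)
    (ContinuousLinearMap.adjoint (inY d d') (gradient f (prodPt x y)))
  have hco1 := hco z
  have hco2 := hco y
  have hCz := hCn z
  clear hco hCn hB hC hfx hfy hgy hHn hHd hfn hfd
  revert i1 i2 hco1 hco2 hCz hCd hBd hbn hbd had
  generalize (ContinuousLinearMap.adjoint (inY d d')).comp ((H (prodPt x z)).comp (inY d d')) = B1
  generalize (ContinuousLinearMap.adjoint (inY d d')).comp ((H (prodPt x y)).comp (inY d d')) = B2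
  generalize (ContinuousLinearMap.adjoint (inY d d')).comp ((H (prodPt x z)).comp (inX d d')) = C1
  generalize (ContinuousLinearMap.adjoint (inY d d')).comp ((H (prodPt x y)).comp (inX d d')) = C2
  generalize ContinuousLinearMap.adjoint (inY d d') (gradient f (prodPt x z)) = b1
  generalize ContinuousLinearMap.adjoint (inY d d') (gradient f (prodPt x y)) = b2
  generalize ContinuousLinearMap.adjoint (inX d d') (gradient f (prodPt x z)) = a1
  generalize ContinuousLinearMap.adjoint (inX d d') (gradient f (prodPt x y)) = a2
  generalize Ring.inverse B1 b1 = u1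
  generalize Ring.inverse B2 b2 = u2
  generalize ‖z - y‖ = δ at hδ ⊢
  intro hCd hBd hbn hbd had i1 i2 hco1 hco2 hCz
  have hu2 : ‖u2‖ ≤ ℓf0 / μg := by
    rw [le_div_iff₀ hμg]
    have := hco2 u2
    rw [i2] at this
    linarith
  have hg2δ : 0 ≤ ℓg2 * δ := (norm_nonneg _).trans hCd
  have hu : ‖u1 - u2‖ ≤ (ℓf1 * δ + ℓg2 * δ * (ℓf0 / μg)) / μg := by
    rw [le_div_iff₀ hμg]
    have h1 := hco1 (u1 - u2)
    have h2 : B1 (u1 - u2) = (b1 - b2) - (B1 - B2) u2 := by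
      rw [map_sub, i1, _root_.sub_apply, i2]; abel
    rw [h2] at h1
    have h3 := norm_sub_le (b1 - b2) ((B1 - B2) u2)
    have h4 := (B1 - B2).le_of_opNorm_le hBd u2
    have h5 := mul_le_mul_of_nonneg_left hu2 hg2δ
    linarith
  have hdec : a1 - ContinuousLinearMap.adjoint C1 u1 - (a2 - ContinuousLinearMap.adjoint C2 u2)
      = (a1 - a2) - (ContinuousLinearMap.adjoint C1 (u1 - u2)
        + ContinuousLinearMap.adjoint (C1 - C2) u2) := by
    simp only [map_sub, _root_.sub_apply]; abel
  rw [hdec]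
  have k1 := norm_sub_le (a1 - a2) (ContinuousLinearMap.adjoint C1 (u1 - u2)
        + ContinuousLinearMap.adjoint (C1 - C2) u2)
  have k2 := norm_add_le (ContinuousLinearMap.adjoint C1 (u1 - u2))
    (ContinuousLinearMap.adjoint (C1 - C2) u2)
  have k3 := adj_apply_bound hCz (u1 - u2)
  have k4 := adj_apply_bound hCd u2
  have k5 := mul_le_mul_of_nonneg_left hu hg1
  have k6 := mul_le_mul_of_nonneg_left hu2 hg2δ
  have e : (ℓf1 + ℓg1 * ℓf1 / μg + (ℓf0 / μg) * (ℓg2 + ℓg1 * ℓg2 / μg)) * δ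
      = ℓf1 * δ + (ℓg1 * ((ℓf1 * δ + ℓg2 * δ * (ℓf0 / μg)) / μg) + ℓg2 * δ * (ℓf0 / μg)) := by
    ring
  rw [e]
  linarith
end
end

section
/- Let f : ℝ^d × ℝ^{d'} → ℝ be differentiable with ∇f being ℓ-Lipschitz continuous on ℝ^d × ℝ^{d'}, and suppose that for every x the function y ↦ f(x,y) is μ-strongly concave with μ > 0 and unique maximizer y*(x). Then F(x) := max_y f(x,y) has Lipschitz gradient with constant L_F := ℓ + ℓ²/μ; that is, ‖∇_x f(x₁, y*(x₁)) − ∇_x f(x₂, y*(x₂))‖ ≤ (ℓ + ℓ²/μ) ‖x₁ − x₂‖ for all x₁, x₂ ∈ ℝ^d. -/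
open scoped InnerProductSpace

noncomputable section

lemma prodPt_sub {d d' : ℕ} (x x' : Euc d) (y y' : Euc d') :
    prodPt x y - prodPt x' y' = prodPt (x - x') (y - y') := rfl

lemma norm_prodPt_left {d d' : ℕ} (x : Euc d) : ‖prodPt x (0 : Euc d')‖ = ‖x‖ := by
  have h : ‖prodPt x (0 : Euc d')‖ ^ 2 = ‖x‖ ^ 2 := by
    rw [WithLp.prod_norm_sq_eq_of_L2]; simp [prodPt]
  exact (sq_eq_sq₀ (norm_nonneg _) (norm_nonneg _)).1 h

lemma norm_prodPt_right {d d' : ℕ} (y : Euc d') : ‖prodPt (0 : Euc d) y‖ = ‖y‖ := by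
  have h : ‖prodPt (0 : Euc d) y‖ ^ 2 = ‖y‖ ^ 2 := by
    rw [WithLp.prod_norm_sq_eq_of_L2]; simp [prodPt]
  exact (sq_eq_sq₀ (norm_nonneg _) (norm_nonneg _)).1 h

/-- Derivative along an affine line. -/
lemma line_deriv_aux {E : Type*} [NormedAddCommGroup E] [InnerProductSpace ℝ E]
    [CompleteSpace E] (f : E → ℝ)
    (hdiff : Differentiable ℝ f) (p v : E) :
    HasDerivAt (fun t : ℝ => f (p + t • v)) ⟪gradient f p, v⟫_ℝ 0 := by
  have h1 : HasFDerivAt f (fderiv ℝ f p) (p + (0 : ℝ) • v) := by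
    simpa using (hdiff p).hasFDerivAt
  have h2 : HasDerivAt (fun t : ℝ => p + t • v) v 0 := by
    simpa using ((hasDerivAt_id (0 : ℝ)).smul_const v).const_add p
  have h3 := h1.comp_hasDerivAt (0 : ℝ) h2
  have h4 : ⟪gradient f p, v⟫_ℝ = fderiv ℝ f p v := by
    simp [gradient]
  rw [h4]
  exact h3

lemma line_deriv {d d' : ℕ} (f : WithLp 2 (Euc d × Euc d') → ℝ)
    (hdiff : Differentiable ℝ f) (p v : WithLp 2 (Euc d × Euc d')) :
    HasDerivAt (fun t : ℝ => f (p + t • v)) ⟪gradient f p, v⟫_ℝ 0 :=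
  line_deriv_aux f hdiff p v

lemma partial_grad {d d' : ℕ} (f : WithLp 2 (Euc d × Euc d') → ℝ)
    (hdiff : Differentiable ℝ f) (x : Euc d) (y : Euc d') (u : Euc d) :
    ⟪gradient (fun x : Euc d => f (prodPt x y)) x, u⟫_ℝ
      = ⟪gradient f (prodPt x y), prodPt u 0⟫_ℝ := by
  have hd : DifferentiableAt ℝ (fun x : Euc d => f (prodPt x y)) x := by
    have : Differentiable ℝ (fun x : Euc d => prodPt x y) := by
      have h : Differentiable ℝ (fun x : Euc d => (x, y)) := by fun_prop
      exact (WithLp.prodContinuousLinearEquiv 2 ℝ (Euc d) (Euc d')).symm.differentiable.comp h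
    exact (hdiff _).comp x (this x)
  have h1 : HasFDerivAt (fun x : Euc d => f (prodPt x y))
      (fderiv ℝ (fun x : Euc d => f (prodPt x y)) x) (x + (0 : ℝ) • u) := by
    simpa using hd.hasFDerivAt
  have h2 : HasDerivAt (fun t : ℝ => x + t • u) u 0 := by
    simpa using ((hasDerivAt_id (0 : ℝ)).smul_const u).const_add x
  have h3 := h1.comp_hasDerivAt (0 : ℝ) h2
  have h4 := line_deriv f hdiff (prodPt x y) (prodPt u 0)
  have h5 : (fun t : ℝ => f (prodPt x y + t • prodPt u 0))
      = (fun x : Euc d => f (prodPt x y)) ∘ (fun t : ℝ => x + t • u) := by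
    funext t
    have : prodPt x y + t • prodPt u (0 : Euc d') = prodPt (x + t • u) (y + t • 0) := rfl
    simp [this]
  rw [h5] at h4
  rw [← h3.unique h4]
  simp [gradient]

lemma first_order {d d' : ℕ} (f : WithLp 2 (Euc d × Euc d') → ℝ)
    (hdiff : Differentiable ℝ f) (μ : ℝ) (x : Euc d)
    (hconc : StrongConvexOn Set.univ μ (fun y : Euc d' => -(f (prodPt x y))))
    (a b : Euc d') :
    f (prodPt x b) ≤ f (prodPt x a) + ⟪gradient f (prodPt x a), prodPt 0 (b - a)⟫_ℝ
      - μ / 2 * ‖a - b‖ ^ 2 := by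
  have h := (line_deriv f hdiff (prodPt x a) (prodPt 0 (b - a))).tendsto_slope_zero_right
  have hc : Filter.Tendsto (fun t : ℝ => f (prodPt x b) - f (prodPt x a)
      + (1 - t) * (μ / 2 * ‖a - b‖ ^ 2)) (nhdsWithin 0 (Set.Ioi 0))
      (nhds (f (prodPt x b) - f (prodPt x a) + (1 - 0) * (μ / 2 * ‖a - b‖ ^ 2))) := by
    apply Filter.Tendsto.mono_left _ nhdsWithin_le_nhds
    apply Continuous.tendsto (f := fun t : ℝ => f (prodPt x b) - f (prodPt x a)
      + (1 - t) * (μ / 2 * ‖a - b‖ ^ 2))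
    fun_prop
  have hle := le_of_tendsto_of_tendsto hc h (by
    filter_upwards [Ioo_mem_nhdsGT (zero_lt_one (α := ℝ))] with t ht
    have hs := hconc.2 (Set.mem_univ a) (Set.mem_univ b) (sub_nonneg.2 ht.2.le) ht.1.le
      (by ring)
    have he : prodPt x a + t • prodPt (0 : Euc d) (b - a)
        = prodPt x ((1 - t) • a + t • b) := by
      have h1 : prodPt x a + t • prodPt (0 : Euc d) (b - a)
        = prodPt (x + t • 0) (a + t • (b - a)) := rfl
      rw [h1]
      congr 1
      · simp
      · module
    simp only [zero_add, zero_smul, add_zero, smul_eq_mul, he] at hs ⊢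
    rw [inv_mul_eq_div, le_div_iff₀ ht.1]
    nlinarith)
  linarith

theorem max_function_gradient_lipschitz {d d' : ℕ}
    (f : WithLp 2 (Euc d × Euc d') → ℝ)
    (hdiff : Differentiable ℝ f)
    (ℓ : ℝ)
    (hgradLip : ∀ p q : WithLp 2 (Euc d × Euc d'),
      ‖gradient f p - gradient f q‖ ≤ ℓ * ‖p - q‖)
    (μ : ℝ) (hμ : 0 < μ)
    (hconc : ∀ x : Euc d,
      StrongConvexOn Set.univ μ (fun y : Euc d' => -(f (prodPt x y))))
    (ystar : Euc d → Euc d')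
    (hmax : ∀ (x : Euc d) (y : Euc d'), f (prodPt x y) ≤ f (prodPt x (ystar x)))
    (huniq : ∀ (x : Euc d) (y : Euc d'),
      (∀ y' : Euc d', f (prodPt x y') ≤ f (prodPt x y)) → y = ystar x) :
    ∀ x₁ x₂ : Euc d,
      ‖gradient (fun x : Euc d => f (prodPt x (ystar x₁))) x₁
          - gradient (fun x : Euc d => f (prodPt x (ystar x₂))) x₂‖
        ≤ (ℓ + ℓ ^ 2 / μ) * ‖x₁ - x₂‖ := by
  intro x₁ x₂
  by_cases hx : x₁ = x₂
  · subst hx; simp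
  have hxpos : 0 < ‖x₁ - x₂‖ := norm_pos_iff.2 (sub_ne_zero.2 hx)
  have hlx : ∀ y : Euc d', ‖gradient f (prodPt x₁ y) - gradient f (prodPt x₂ y)‖
      ≤ ℓ * ‖x₁ - x₂‖ := fun y => by
    have h := hgradLip (prodPt x₁ y) (prodPt x₂ y)
    rwa [prodPt_sub, sub_self, norm_prodPt_left] at h
  have hl : 0 ≤ ℓ := by
    have h := (norm_nonneg _).trans (hlx 0)
    exact nonneg_of_mul_nonneg_left h hxpos
  -- stationarity of the maximizer
  have hstat : ∀ (x : Euc d) (v : Euc d'),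
      ⟪gradient f (prodPt x (ystar x)), prodPt 0 v⟫_ℝ = 0 := fun x v => by
    have h := line_deriv f hdiff (prodPt x (ystar x)) (prodPt 0 v)
    refine IsLocalMax.hasDerivAt_eq_zero (Filter.Eventually.of_forall fun t => ?_) h
    have h1 : prodPt x (ystar x) + t • prodPt (0 : Euc d) v
        = prodPt (x + t • 0) (ystar x + t • v) := rfl
    simp only [h1, zero_smul, add_zero, smul_zero]
    exact hmax _ _
  -- the maximizer map is Lipschitz
  have hy : ‖ystar x₁ - ystar x₂‖ ≤ ℓ / μ * ‖x₁ - x₂‖ := by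
    have h1 := first_order f hdiff μ x₂ (hconc x₂) (ystar x₁) (ystar x₂)
    have h2 := first_order f hdiff μ x₂ (hconc x₂) (ystar x₂) (ystar x₁)
    rw [hstat] at h2
    rw [norm_sub_rev (ystar x₂)] at h2
    have h3 := hstat x₁ (ystar x₂ - ystar x₁)
    have h4 := abs_le.1 (abs_real_inner_le_norm
      (gradient f (prodPt x₁ (ystar x₁)) - gradient f (prodPt x₂ (ystar x₁)))
      (prodPt 0 (ystar x₂ - ystar x₁)))
    rw [inner_sub_left, h3, norm_prodPt_right, norm_sub_rev (ystar x₂)] at h4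
    have h5 := mul_le_mul_of_nonneg_right (hlx (ystar x₁)) (norm_nonneg (ystar x₁ - ystar x₂))
    have h6 : μ * ‖ystar x₁ - ystar x₂‖ ^ 2
        ≤ ℓ * ‖x₁ - x₂‖ * ‖ystar x₁ - ystar x₂‖ := by linarith [h4.1]
    rcases (norm_nonneg (ystar x₁ - ystar x₂)).eq_or_lt with h0 | h0
    · rw [← h0]; positivity
    · rw [div_mul_eq_mul_div, le_div_iff₀ hμ]
      refine le_of_mul_le_mul_right ?_ h0
      linarith
  have hG : ‖gradient f (prodPt x₁ (ystar x₁)) - gradient f (prodPt x₂ (ystar x₂))‖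
      ≤ (ℓ + ℓ ^ 2 / μ) * ‖x₁ - x₂‖ := by
    have h1 := hgradLip (prodPt x₂ (ystar x₁)) (prodPt x₂ (ystar x₂))
    rw [prodPt_sub, sub_self, norm_prodPt_right] at h1
    have h2 := norm_sub_le_norm_sub_add_norm_sub (gradient f (prodPt x₁ (ystar x₁)))
      (gradient f (prodPt x₂ (ystar x₁))) (gradient f (prodPt x₂ (ystar x₂)))
    have h3 := mul_le_mul_of_nonneg_left hy hl
    have h4 : ℓ * (ℓ / μ * ‖x₁ - x₂‖) = ℓ ^ 2 / μ * ‖x₁ - x₂‖ := by ring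
    linarith [hlx (ystar x₁)]
  refine le_trans ?_ hG
  set D := gradient (fun x : Euc d => f (prodPt x (ystar x₁))) x₁
          - gradient (fun x : Euc d => f (prodPt x (ystar x₂))) x₂ with hD
  have h1 : ‖D‖ ^ 2 = ⟪gradient f (prodPt x₁ (ystar x₁)) - gradient f (prodPt x₂ (ystar x₂)),
      prodPt D 0⟫_ℝ := by
    rw [← real_inner_self_eq_norm_sq]
    nth_rewrite 1 [hD]
    rw [inner_sub_left, inner_sub_left, partial_grad f hdiff, partial_grad f hdiff]
  have h2 := real_inner_le_norm
    (gradient f (prodPt x₁ (ystar x₁)) - gradient f (prodPt x₂ (ystar x₂))) (prodPt D 0)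
  rw [← h1, norm_prodPt_left] at h2
  rcases (norm_nonneg D).eq_or_lt with h0 | h0
  · rw [← h0]; positivity
  · refine le_of_mul_le_mul_right ?_ h0
    linarith
end
end
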